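/- (Equation (2): Bayes risk of the sum-of-squares loss under the Dirichlet) Let y : Fin K → ℝ be a one-hot vector (y j = 1 for some j : Fin K and y k = 0 for k ≠ j). Then ∫_T (∑_k (y k − π(x) k)²) · dirα(x) dx = ∑_k ((y k − α k / α₀)² + α k (α₀ − α k) / (α₀² (α₀ + 1))), i.e. the Bayes risk of the SSE loss decomposes as the sum over classes of a squared error term and a variance term. -/

import Mathlib

open MeasureTheory

/-- The open parameter domain of the probability simplex over `K` outcomes:
vectors of the first `K-1` coordinates, all positive, summing to less than 1. -/
def simplexT (K : ℕ) : Set (Fin (K - 1) → ℝ) :=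
  {x | (∀ i, 0 < x i) ∧ ∑ i, x i < 1}

/-- The point of the probability simplex over `K` outcomes determined by its
first `K-1` coordinates: `π(x) i = x i` for `i < K-1` and
`π(x) (K-1) = 1 - ∑ᵢ x i`. -/
noncomputable def simplexCoord (K : ℕ) (x : Fin (K - 1) → ℝ) (i : Fin K) : ℝ :=
  if h : (i : ℕ) < K - 1 then x ⟨i, h⟩ else 1 - ∑ m, x m

/-- The Dirichlet density with parameter `α`, in the simplex parametrization. -/
noncomputable def dirDensity (K : ℕ) (α : Fin K → ℝ) (x : Fin (K - 1) → ℝ) : ℝ :=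
  (Real.Gamma (∑ k, α k) / ∏ k, Real.Gamma (α k)) *
    ∏ k, simplexCoord K x k ^ (α k - 1)

open Set

/-- The scaled beta integral, as a Lebesgue integral. -/
lemma lintegral_rpow_mul_sub_rpow {a b s : ℝ} (ha : 0 < a) (hb : 0 < b) (hs : 0 < s) :
    ∫⁻ t in Ioo 0 s, ENNReal.ofReal (t ^ (a - 1) * (s - t) ^ (b - 1)) =
      ENNReal.ofReal (Real.Gamma a * Real.Gamma b / Real.Gamma (a + b) * s ^ (a + b - 1)) := by
  have hβ : 0 < ProbabilityTheory.beta a b := ProbabilityTheory.beta_pos ha hb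
  have himg : (fun u : ℝ => s * u) '' Ioo 0 1 = Ioo 0 s := by
    rw [image_mul_left_Ioo hs]; simp
  have hunit := ProbabilityTheory.lintegral_betaPDF_eq_one ha hb
  rw [ProbabilityTheory.lintegral_betaPDF] at hunit
  rw [← himg, lintegral_image_eq_lintegral_abs_deriv_mul measurableSet_Ioo
    (fun u _ => ((hasDerivAt_id' u).const_mul s).hasDerivWithinAt)
    (mul_right_injective₀ hs.ne').injOn]
  have hpt : ∀ u ∈ Ioo (0 : ℝ) 1,
      ENNReal.ofReal |s * 1| * ENNReal.ofReal ((s * u) ^ (a - 1) * (s - s * u) ^ (b - 1)) =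
        ENNReal.ofReal (ProbabilityTheory.beta a b * s ^ (a + b - 1)) *
          ENNReal.ofReal (1 / ProbabilityTheory.beta a b * u ^ (a - 1) * (1 - u) ^ (b - 1)) := by
    intro u hu
    have hpow : s ^ (a + b - 1) = s * (s ^ (a - 1) * s ^ (b - 1)) := by
      nth_rw 2 [← Real.rpow_one s]
      rw [← Real.rpow_add hs, ← Real.rpow_add hs]
      ring_nf
    rw [← ENNReal.ofReal_mul (abs_nonneg _), ← ENNReal.ofReal_mul (by positivity), mul_one,
      abs_of_pos hs, Real.mul_rpow hs.le hu.1.le, show s - s * u = s * (1 - u) by ring,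
      Real.mul_rpow hs.le (by linarith [hu.2]), hpow]
    congr 1
    field_simp
  rw [setLIntegral_congr_fun measurableSet_Ioo hpt, lintegral_const_mul _ (by fun_prop), hunit,
    mul_one, ProbabilityTheory.beta]

/-- The open corner simplex of size `s`. -/
def cornerSimplex (n : ℕ) (s : ℝ) : Set (Fin n → ℝ) :=
  {x | (∀ i, 0 < x i) ∧ ∑ i, x i < s}

lemma measurableSet_cornerSimplex (n : ℕ) (s : ℝ) : MeasurableSet (cornerSimplex n s) := by
  unfold cornerSimplex
  measurability

lemma cons_mem_cornerSimplex {n : ℕ} {s t : ℝ} {z : Fin n → ℝ} :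
    (Fin.cons t z : Fin (n + 1) → ℝ) ∈ cornerSimplex (n + 1) s ↔
      t ∈ Ioo 0 s ∧ z ∈ cornerSimplex n (s - t) := by
  simp only [cornerSimplex, mem_ofPred_eq, Fin.forall_fin_succ, Fin.sum_univ_succ, Fin.cons_zero,
    Fin.cons_succ, mem_Ioo]
  constructor
  · rintro ⟨⟨ht, hz⟩, h⟩
    have := Finset.sum_nonneg fun i (_ : i ∈ Finset.univ) => (hz i).le
    exact ⟨⟨ht, by linarith⟩, hz, by linarith⟩
  · rintro ⟨⟨ht, -⟩, hz, h⟩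
    exact ⟨⟨ht, hz⟩, by linarith⟩

/-- Dirichlet's integral over the corner simplex of size `s`. -/
lemma lintegral_cornerSimplex {n : ℕ} {a : Fin n → ℝ} (ha : ∀ i, 0 < a i) {b s : ℝ} (hb : 0 < b)
    (hs : 0 < s) :
    ∫⁻ x in cornerSimplex n s,
        ENNReal.ofReal ((∏ i, x i ^ (a i - 1)) * (s - ∑ i, x i) ^ (b - 1)) =
      ENNReal.ofReal ((∏ i, Real.Gamma (a i)) * Real.Gamma b / Real.Gamma (∑ i, a i + b) *
        s ^ (∑ i, a i + b - 1)) := by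
  induction n generalizing s with
  | zero =>
    have huniv : cornerSimplex 0 s = univ := by ext; simp [cornerSimplex, hs]
    simp [huniv, volume_pi, (Real.Gamma_pos_of_pos hb).ne']
  | succ n ih =>
    set A := ∑ i : Fin n, a i.succ + b with hA
    have hA0 : 0 < A := add_pos_of_nonneg_of_pos (Finset.sum_nonneg fun i _ => (ha _).le) hb
    set C := (∏ i : Fin n, Real.Gamma (a i.succ)) * Real.Gamma b / Real.Gamma A with hC
    have hC0 : 0 ≤ C := div_nonneg (mul_nonneg (Finset.prod_nonneg fun i _ =>
      (Real.Gamma_pos_of_pos (ha _)).le) (Real.Gamma_pos_of_pos hb).le)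
      (Real.Gamma_pos_of_pos hA0).le
    set F : (Fin (n + 1) → ℝ) → ENNReal := fun x =>
      ENNReal.ofReal ((∏ i, x i ^ (a i - 1)) * (s - ∑ i, x i) ^ (b - 1)) with hF
    have hFm : Measurable F := by fun_prop
    have hslice : ∀ t : ℝ, ∫⁻ z, (cornerSimplex (n + 1) s).indicator F (Fin.cons t z) =
        (Ioo 0 s).indicator (fun t => ENNReal.ofReal C *
          ENNReal.ofReal (t ^ (a 0 - 1) * (s - t) ^ (A - 1))) t := by
      intro t
      by_cases ht : t ∈ Ioo 0 s
      · rw [indicator_of_mem ht]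
        have hind : ∀ z : Fin n → ℝ, (cornerSimplex (n + 1) s).indicator F (Fin.cons t z) =
            (cornerSimplex n (s - t)).indicator (fun z => ENNReal.ofReal (t ^ (a 0 - 1)) *
              ENNReal.ofReal ((∏ i, z i ^ (a i.succ - 1)) * (s - t - ∑ i, z i) ^ (b - 1))) z := by
          intro z
          by_cases hz : z ∈ cornerSimplex n (s - t)
          · rw [indicator_of_mem (cons_mem_cornerSimplex.2 ⟨ht, hz⟩), indicator_of_mem hz, hF,
              ← ENNReal.ofReal_mul (Real.rpow_nonneg ht.1.le _)]
            simp only [Fin.prod_univ_succ, Fin.sum_univ_succ, Fin.cons_zero, Fin.cons_succ,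
              mul_assoc, sub_sub]
          · rw [indicator_of_notMem (fun h => hz (cons_mem_cornerSimplex.1 h).2),
              indicator_of_notMem hz]
        simp_rw [hind]
        rw [lintegral_indicator (measurableSet_cornerSimplex _ _),
          lintegral_const_mul _ (by fun_prop), ih (fun i => ha _) (sub_pos.2 ht.2), ← hA, ← hC,
          ← ENNReal.ofReal_mul (Real.rpow_nonneg ht.1.le _), ← ENNReal.ofReal_mul hC0]
        congr 1
        ring
      · rw [indicator_of_notMem ht]
        simp_rw [indicator_of_notMem (fun h => ht (cons_mem_cornerSimplex.1 h).1)]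
        simp
    have hmeas : Measurable ((cornerSimplex (n + 1) s).indicator F) :=
      hFm.indicator (measurableSet_cornerSimplex _ _)
    rw [← lintegral_indicator (measurableSet_cornerSimplex _ _),
      ← (volume_preserving_piFinSuccAbove (fun _ : Fin (n + 1) => ℝ) 0).symm.lintegral_comp hmeas,
      Measure.volume_eq_prod, lintegral_prod _ (by fun_prop)]
    change ∫⁻ t : ℝ, ∫⁻ z : Fin n → ℝ, (cornerSimplex (n + 1) s).indicator F
      (Fin.insertNth (α := fun _ => ℝ) 0 t z) = _
    simp only [Fin.insertNth_zero', hslice]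
    rw [lintegral_indicator measurableSet_Ioo, lintegral_const_mul _ (by fun_prop),
      lintegral_rpow_mul_sub_rpow (ha 0) hA0 hs, ← ENNReal.ofReal_mul hC0, Fin.sum_univ_succ,
      Fin.prod_univ_succ, add_assoc, ← hA, hC]
    congr 1
    have := (Real.Gamma_pos_of_pos hA0).ne'
    field_simp

lemma simplexCoord_castSucc {n : ℕ} (x : Fin n → ℝ) (i : Fin n) :
    simplexCoord (n + 1) x i.castSucc = x i := by
  simp [simplexCoord]

lemma simplexCoord_last {n : ℕ} (x : Fin n → ℝ) :
    simplexCoord (n + 1) x (Fin.last n) = 1 - ∑ i, x i := by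
  simp [simplexCoord]

lemma simplexCoord_pos {K : ℕ} {x : Fin (K - 1) → ℝ} (hx : x ∈ simplexT K) (k : Fin K) :
    0 < simplexCoord K x k := by
  unfold simplexCoord
  split_ifs
  · exact hx.1 _
  · linarith [hx.2]

lemma measurableSet_simplexT (K : ℕ) : MeasurableSet (simplexT K) :=
  measurableSet_cornerSimplex (K - 1) 1

@[fun_prop]
lemma measurable_simplexCoord (K : ℕ) (k : Fin K) : Measurable fun x => simplexCoord K x k := by
  unfold simplexCoord
  split_ifs <;> fun_prop

@[fun_prop]
lemma measurable_dirDensity (K : ℕ) (α : Fin K → ℝ) : Measurable (dirDensity K α) := by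
  unfold dirDensity
  fun_prop

/-- The Dirichlet density integrates to one. -/
lemma integral_dirDensity {K : ℕ} (hK : K ≠ 0) {α : Fin K → ℝ} (hα : ∀ k, 0 < α k) :
    ∫ x in simplexT K, dirDensity K α x = 1 := by
  obtain ⟨n, rfl⟩ := Nat.exists_eq_succ_of_ne_zero hK
  have hsum : 0 < ∑ k, α k := Finset.sum_pos (fun k _ => hα k) Finset.univ_nonempty
  have hΓ : 0 < Real.Gamma (∑ k, α k) := Real.Gamma_pos_of_pos hsum
  have hΓp : 0 < ∏ k, Real.Gamma (α k) :=
    Finset.prod_pos fun k _ => Real.Gamma_pos_of_pos (hα k)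
  have hnorm := lintegral_cornerSimplex (fun i : Fin n => hα i.castSucc) (hα (Fin.last n))
    one_pos
  rw [Real.one_rpow, mul_one, ← Fin.sum_univ_castSucc α,
    ← Fin.prod_univ_castSucc (fun k => Real.Gamma (α k))] at hnorm
  have hpos : ∀ x ∈ simplexT (n + 1), 0 ≤ dirDensity (n + 1) α x := fun x hx =>
    mul_nonneg (div_pos hΓ hΓp).le
      (Finset.prod_nonneg fun k _ => Real.rpow_nonneg (simplexCoord_pos hx k).le _)
  have hval : ∀ x : Fin n → ℝ, ENNReal.ofReal (dirDensity (n + 1) α x) =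
      ENNReal.ofReal (Real.Gamma (∑ k, α k) / ∏ k, Real.Gamma (α k)) *
        ENNReal.ofReal ((∏ i : Fin n, x i ^ (α i.castSucc - 1)) *
          (1 - ∑ i, x i) ^ (α (Fin.last n) - 1)) := by
    intro x
    rw [← ENNReal.ofReal_mul (div_pos hΓ hΓp).le, dirDensity,
      Fin.prod_univ_castSucc (fun k => simplexCoord (n + 1) x k ^ (α k - 1))]
    simp only [simplexCoord_castSucc, simplexCoord_last]
  rw [integral_eq_lintegral_of_nonneg_ae
    (ae_restrict_of_forall_mem (measurableSet_simplexT _) hpos)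
    (measurable_dirDensity _ _).aestronglyMeasurable]
  change (∫⁻ x : Fin n → ℝ in cornerSimplex n 1, _).toReal = 1
  simp_rw [hval]
  rw [lintegral_const_mul _ (by fun_prop), hnorm, ← ENNReal.ofReal_mul (div_pos hΓ hΓp).le,
    div_mul_div_cancel₀ hΓp.ne', div_self hΓ.ne', ENNReal.ofReal_one, ENNReal.toReal_one]

lemma integrableOn_dirDensity {K : ℕ} (hK : K ≠ 0) {α : Fin K → ℝ} (hα : ∀ k, 0 < α k) :
    IntegrableOn (dirDensity K α) (simplexT K) :=
  integrable_of_integral_eq_one (integral_dirDensity hK hα)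

lemma update_add_one_pos {ι : Type*} [DecidableEq ι] {α : ι → ℝ} (hα : ∀ k, 0 < α k) (k m : ι) :
    0 < Function.update α k (α k + 1) m :=
  (Function.forall_update_iff α fun _ c => 0 < c).2
    ⟨by linarith [hα k], fun m _ => hα m⟩ m

lemma sum_update_add_one {ι : Type*} [Fintype ι] [DecidableEq ι] (α : ι → ℝ) (k : ι) :
    ∑ m, Function.update α k (α k + 1) m = ∑ m, α m + 1 := by
  rw [Finset.sum_update_of_mem (Finset.mem_univ k), ← Finset.erase_eq,
    ← Finset.add_sum_erase _ α (Finset.mem_univ k)]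
  ring

lemma simplexCoord_mul_dirDensity {K : ℕ} {α : Fin K → ℝ} (hα : ∀ k, 0 < α k) (k : Fin K)
    {x : Fin (K - 1) → ℝ} (hx : x ∈ simplexT K) :
    simplexCoord K x k * dirDensity K α x =
      α k / (∑ m, α m) * dirDensity K (Function.update α k (α k + 1)) x := by
  have hsum : 0 < ∑ m, α m := Finset.sum_pos (fun m _ => hα m) ⟨k, Finset.mem_univ k⟩
  have hprod : ∀ g : Fin K → ℝ → ℝ, ∏ m, g m (Function.update α k (α k + 1) m) =
      g k (α k + 1) * ∏ m ∈ Finset.univ.erase k, g m (α m) := by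
    intro g
    rw [← Finset.mul_prod_erase _ _ (Finset.mem_univ k), Function.update_self]
    congr 1
    refine Finset.prod_congr rfl fun m hm => ?_
    rw [Function.update_of_ne (Finset.ne_of_mem_erase hm)]
  unfold dirDensity
  rw [sum_update_add_one, hprod fun _ => Real.Gamma, hprod fun m c => simplexCoord K x m ^ (c - 1),
    Real.Gamma_add_one hsum.ne', Real.Gamma_add_one (hα k).ne', add_sub_cancel_right,
    ← Finset.mul_prod_erase _ (fun m => Real.Gamma (α m)) (Finset.mem_univ k),
    ← Finset.mul_prod_erase _ (fun m => simplexCoord K x m ^ (α m - 1)) (Finset.mem_univ k),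
    Real.rpow_sub_one (simplexCoord_pos hx k).ne']
  have h1 := (simplexCoord_pos hx k).ne'
  have h2 := (Real.Gamma_pos_of_pos (hα k)).ne'
  have h3 := (hα k).ne'
  have h4 : ∏ m ∈ Finset.univ.erase k, Real.Gamma (α m) ≠ 0 :=
    Finset.prod_ne_zero_iff.2 fun m _ => (Real.Gamma_pos_of_pos (hα m)).ne'
  field_simp

lemma simplexCoord_sq_mul_dirDensity {K : ℕ} {α : Fin K → ℝ} (hα : ∀ k, 0 < α k) (k : Fin K)
    {x : Fin (K - 1) → ℝ} (hx : x ∈ simplexT K) :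
    simplexCoord K x k ^ 2 * dirDensity K α x =
      α k / (∑ m, α m) * ((α k + 1) / (∑ m, α m + 1)) *
        dirDensity K (Function.update α k (α k + 2)) x := by
  have h := simplexCoord_mul_dirDensity (update_add_one_pos hα k) k hx
  rw [Function.update_self, sum_update_add_one, Function.update_idem, add_assoc,
    one_add_one_eq_two] at h
  rw [pow_two, mul_assoc, simplexCoord_mul_dirDensity hα k hx, mul_left_comm, h]
  ring

/-- The Bayes risk of the squared error in a single coordinate. -/
lemma integral_sq_sub_simplexCoord_mul {K : ℕ} {α : Fin K → ℝ} (hα : ∀ k, 0 < α k) (c : ℝ)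
    (k : Fin K) :
    IntegrableOn (fun x => (c - simplexCoord K x k) ^ 2 * dirDensity K α x) (simplexT K) ∧
      ∫ x in simplexT K, (c - simplexCoord K x k) ^ 2 * dirDensity K α x =
        (c - α k / ∑ m, α m) ^ 2 +
          α k * ((∑ m, α m) - α k) / ((∑ m, α m) ^ 2 * ((∑ m, α m) + 1)) := by
  have hK : K ≠ 0 := k.pos.ne'
  have hsum : 0 < ∑ m, α m := Finset.sum_pos (fun m _ => hα m) ⟨k, Finset.mem_univ k⟩
  have hα₁ := update_add_one_pos hα k
  have hα₂ : ∀ m, 0 < Function.update α k (α k + 2) m :=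
    (Function.forall_update_iff α fun _ c => 0 < c).2 ⟨by linarith [hα k], fun m _ => hα m⟩
  have hexp : EqOn (fun x => (c - simplexCoord K x k) ^ 2 * dirDensity K α x)
      (fun x => c ^ 2 * dirDensity K α x
        - 2 * c * (α k / ∑ m, α m) * dirDensity K (Function.update α k (α k + 1)) x
        + α k / (∑ m, α m) * ((α k + 1) / (∑ m, α m + 1)) *
          dirDensity K (Function.update α k (α k + 2)) x) (simplexT K) := by
    intro x hx
    linear_combination (-2 * c) * simplexCoord_mul_dirDensity hα k hx +
      simplexCoord_sq_mul_dirDensity hα k hx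
  have hi₀ := (integrableOn_dirDensity hK hα).const_mul (c ^ 2)
  have hi₁ := (integrableOn_dirDensity hK hα₁).const_mul (2 * c * (α k / ∑ m, α m))
  have hi₂ := (integrableOn_dirDensity hK hα₂).const_mul
    (α k / (∑ m, α m) * ((α k + 1) / (∑ m, α m + 1)))
  refine ⟨(integrableOn_congr_fun hexp (measurableSet_simplexT K)).2 ((hi₀.sub hi₁).add hi₂), ?_⟩
  rw [setIntegral_congr_fun (measurableSet_simplexT K) hexp]
  refine (integral_add (hi₀.sub hi₁) hi₂).trans ?_
  rw [integral_sub' hi₀ hi₁]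
  simp only [integral_const_mul, integral_dirDensity hK hα, integral_dirDensity hK hα₁,
    integral_dirDensity hK hα₂]
  field_simp
  ring

/-- Equation (2): the Bayes risk of the sum-of-squares loss under the Dirichlet
distribution decomposes as the sum over classes of a squared error term and a
variance term. -/
theorem dirichlet_sse_bayes_risk (K : ℕ) (hK : 2 ≤ K)
    (α : Fin K → ℝ) (hα : ∀ k, 0 < α k)
    (j : Fin K) (y : Fin K → ℝ) (hyj : y j = 1) (hy : ∀ k, k ≠ j → y k = 0) :
    ∫ x in simplexT K, (∑ k, (y k - simplexCoord K x k) ^ 2) * dirDensity K α x =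
      ∑ k, ((y k - α k / ∑ m, α m) ^ 2 +
        α k * ((∑ m, α m) - α k) / ((∑ m, α m) ^ 2 * ((∑ m, α m) + 1))) := by
  simp_rw [Finset.sum_mul]
  rw [integral_finsetSum _ fun k _ => (integral_sq_sub_simplexCoord_mul hα (y k) k).1]
  exact Finset.sum_congr rfl fun k _ => (integral_sq_sub_simplexCoord_mul hα (y k) k).2
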